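/- Let M⁴₄₁ = ∂A⁵₄₁ be the boundary complex of A⁵₄₁, where A⁵₄₁ is the pure 5-dimensional simplicial complex on V₄₁ = {a₀, …, a₄₀} whose 246 facets are the Z₄₁-images (indices mod 41) of a₃₆a₃₇a₃₈a₃₉a₄₀a₀, a₃₆a₃₇a₃₈a₃₉a₀a₆, a₃₇a₃₈a₃₉a₀a₆a₁₃, a₃₈a₃₉a₀a₆a₁₃a₂₀, a₃₉a₀a₆a₁₃a₂₀a₂₇, a₆a₁₃a₂₀a₂₇a₃₄a₀. Then M⁴₄₁ is a 2-neighborly 4-dimensional weak pseudomanifold on 41 vertices admitting the vertex-transitive automorphism a_i ↦ a_{i+1}, every vertex link of M⁴₄₁ is a stacked 3-sphere (i.e., M⁴₄₁ ∈ K(4)), its face vector is (f₀, f₁, f₂, f₃, f₄) = (41, 820, 2050, 2255, 902), and its Euler characteristic is χ = −82, so that f₀(f₀ − 11) = −15χ. -/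

import Mathlib

variable {V : Type*} [DecidableEq V]

/-- The number of faces of the complex with facet set `F` having exactly `k` vertices
(i.e. of dimension `k - 1`). -/
def faceCount (F : Finset (Finset V)) (k : ℕ) : ℕ :=
  (F.biUnion fun σ => σ.powersetCard k).card

/-- The vertex set of the complex with facet set `F`. -/
def vertexSet (F : Finset (Finset V)) : Finset V := F.biUnion id

/-- The dual graph of a pure `d`-dimensional complex given by its facet set `F`:
two facets are adjacent iff their intersection has `d` vertices (dimension `d-1`). -/
def dualGraph (d : ℕ) (F : Finset (Finset V)) : SimpleGraph {σ // σ ∈ F} where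
  Adj σ τ := σ ≠ τ ∧ (σ.1 ∩ τ.1).card = d
  symm := ⟨fun σ τ h => ⟨h.1.symm, by rw [Finset.inter_comm]; exact h.2⟩⟩
  loopless := ⟨fun σ h => h.1 rfl⟩

/-- `IsStackedBall d F` : the pure `d`-dimensional complex with facet set `F` is a
stacked `d`-ball, i.e. it is obtained from a single `d`-simplex by repeatedly gluing
a new `d`-simplex `σ` along a single `(d-1)`-face `τ` lying in exactly one facet of the previous complex
(so that the intersection of the old complex with the new simplex is exactly `τ̄`). -/
inductive IsStackedBall : ℕ → Finset (Finset V) → Prop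
  | single (d : ℕ) (σ : Finset V) (h : σ.card = d + 1) : IsStackedBall d {σ}
  | glue (d : ℕ) (F : Finset (Finset V)) (σ τ : Finset V) :
      IsStackedBall d F → σ.card = d + 1 → σ ∉ F → τ ⊆ σ → τ.card = d →
      (∃! ρ, ρ ∈ F ∧ τ ⊆ ρ) → (∀ ρ ∈ F, ρ ∩ σ ⊆ τ) → IsStackedBall d (insert σ F)

/-- The facet set of the link of the vertex `x` in the pure complex with facet set `F`. -/
def linkFacets (F : Finset (Finset V)) (x : V) : Finset (Finset V) :=
  (F.filter fun σ => x ∈ σ).image fun σ => σ.erase x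

/-- The facet set of the boundary of a pure `d`-dimensional weak pseudomanifold with
facet set `F` : the `d`-element subsets of facets lying in exactly one facet. -/
def bdryFacets (d : ℕ) (F : Finset (Finset V)) : Finset (Finset V) :=
  (F.biUnion fun σ => σ.powersetCard d).filter fun τ => (F.filter fun σ => τ ⊆ σ).card = 1

/-- A complex (given by its facet set `S`) is a stacked `d`-sphere if it is the boundary
of a stacked `(d+1)`-ball. -/
def IsStackedSphere (d : ℕ) (S : Finset (Finset V)) : Prop :=
  ∃ B : Finset (Finset V), IsStackedBall (d + 1) B ∧ S = bdryFacets (d + 1) B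

/-- The `Z₄₁`-action `j ⬝ a_k = a_{j+k}` on `V₄₁ = Z₄₁`. -/
def shift41 (j : ZMod 41) (σ : Finset (ZMod 41)) : Finset (ZMod 41) :=
  σ.image fun p => p + j

/-- The six basic facets of `A⁵₄₁`. -/
def baseA41 : Finset (Finset (ZMod 41)) :=
  { {36, 37, 38, 39, 40, 0}, {36, 37, 38, 39, 0, 6}, {37, 38, 39, 0, 6, 13},
    {38, 39, 0, 6, 13, 20}, {39, 0, 6, 13, 20, 27}, {6, 13, 20, 27, 34, 0} }

/-- The facet set of `A⁵₄₁` : all `Z₄₁`-images of the six basic facets. -/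
def A41 : Finset (Finset (ZMod 41)) :=
  (Finset.univ : Finset (ZMod 41)).biUnion fun j => baseA41.image (shift41 j)

/-- The facet set of the boundary complex `M⁴₄₁ = ∂A⁵₄₁`. -/
def M41 : Finset (Finset (ZMod 41)) := bdryFacets 5 A41

/-! ### Sets of residues coded by increasing lists of natural numbers -/

def gd (l : List ℕ) : Bool := decide (l.Pairwise (· < ·)) && l.all (fun n => Nat.blt n 41)

def cd (x : ZMod 41) (l : List ℕ) : Finset (ZMod 41) :=
  (l.map (fun n : ℕ => (n : ZMod 41) + x)).toFinset

def cds (x : ZMod 41) (L : List (List ℕ)) : Finset (Finset (ZMod 41)) :=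
  L.toFinset.image (cd x)

def subB (t l : List ℕ) : Bool := t.all (fun n => l.any (fun m => Nat.beq n m))

def beqL : List ℕ → List ℕ → Bool
  | [], [] => true
  | [], _ :: _ => false
  | _ :: _, [] => false
  | a :: l, b :: m => cond (Nat.beq a b) (beqL l m) false

def cnt : List (List ℕ) → ℕ
  | [] => 0
  | a :: l => cond (l.any (beqL a)) (cnt l) (cnt l + 1)

def facesL (k : ℕ) (L : List (List ℕ)) : List (List ℕ) := L.flatMap (List.sublistsLen k)

def starF (t : List ℕ) (L : List (List ℕ)) : List (List ℕ) := L.filter (subB t)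

def bdL (d : ℕ) (L : List (List ℕ)) : List (List ℕ) :=
  (facesL d L).filter (fun t => Nat.beq (cnt (starF t L)) 1)

def stk : List (List ℕ) → Bool
  | [] => false
  | [a] => Nat.beq a.length 5
  | s :: r :: L => stk (r :: L) && Nat.beq s.length 5 && (List.sublistsLen 4 s).any (fun t =>
      Nat.beq (cnt (starF t (r :: L))) 1 &&
        (r :: L).all (fun u => s.all (fun n => cond (u.any (Nat.beq n)) (t.any (Nat.beq n)) true)))

def lk36 : List (List ℕ) :=
  [[30, 31, 32, 33, 35], [24, 25, 26, 28, 34], [18, 19, 21, 27, 34], [12, 14, 20, 27, 34],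
   [7, 31, 32, 33, 35], [7, 25, 26, 28, 34], [7, 19, 21, 27, 34], [7, 14, 32, 33, 35],
   [7, 14, 26, 28, 34], [7, 14, 21, 33, 35], [7, 14, 21, 28, 35], [7, 14, 21, 28, 34],
   [7, 14, 21, 27, 34], [7, 14, 20, 27, 34], [7, 13, 20, 27, 34], [6, 13, 20, 27, 34],
   [6, 13, 20, 27, 39], [6, 13, 20, 38, 39], [6, 13, 37, 38, 39], [6, 36, 37, 38, 39],
   [36, 37, 38, 39, 40], [2, 8, 15, 22, 29], [2, 8, 15, 22, 40], [2, 8, 15, 39, 40],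
   [2, 8, 38, 39, 40], [1, 37, 38, 39, 40], [1, 3, 9, 16, 23], [1, 3, 9, 16, 40],
   [1, 3, 9, 39, 40], [1, 2, 38, 39, 40], [1, 2, 4, 10, 17], [1, 2, 4, 10, 40],
   [1, 2, 3, 39, 40], [1, 2, 3, 5, 11], [1, 2, 3, 4, 40], [1, 2, 3, 4, 5]]

def bd110 : List (List ℕ) :=
  [[30, 31, 32, 33], [30, 31, 32, 35], [30, 31, 33, 35], [30, 32, 33, 35], [24, 25, 26, 28], [24, 25, 26, 34],
   [24, 25, 28, 34], [24, 26, 28, 34], [18, 19, 21, 27], [18, 19, 21, 34], [18, 19, 27, 34], [18, 21, 27, 34],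
   [12, 14, 20, 27], [12, 14, 20, 34], [12, 14, 27, 34], [12, 20, 27, 34], [7, 31, 32, 33], [7, 31, 32, 35],
   [7, 31, 33, 35], [7, 25, 26, 28], [7, 25, 26, 34], [7, 25, 28, 34], [7, 19, 21, 27], [7, 19, 21, 34],
   [7, 19, 27, 34], [7, 14, 32, 33], [7, 14, 32, 35], [14, 32, 33, 35], [7, 14, 26, 28], [7, 14, 26, 34],
   [14, 26, 28, 34], [7, 14, 21, 33], [7, 21, 33, 35], [14, 21, 33, 35], [7, 14, 28, 35], [7, 21, 28, 35],
   [14, 21, 28, 35], [7, 21, 28, 34], [14, 21, 28, 34], [7, 14, 21, 27], [14, 21, 27, 34], [7, 14, 20, 27],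
   [7, 14, 20, 34], [7, 13, 20, 27], [7, 13, 20, 34], [7, 13, 27, 34], [6, 13, 20, 34], [6, 13, 27, 34],
   [6, 20, 27, 34], [6, 13, 27, 39], [6, 20, 27, 39], [13, 20, 27, 39], [6, 13, 20, 38], [6, 20, 38, 39],
   [13, 20, 38, 39], [6, 13, 37, 38], [6, 13, 37, 39], [13, 37, 38, 39], [6, 36, 37, 38], [6, 36, 37, 39],
   [6, 36, 38, 39], [36, 37, 38, 40], [36, 37, 39, 40], [36, 38, 39, 40], [2, 8, 15, 29], [2, 8, 22, 29],
   [2, 15, 22, 29], [8, 15, 22, 29], [2, 8, 22, 40], [2, 15, 22, 40], [8, 15, 22, 40], [2, 8, 15, 39],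
   [2, 15, 39, 40], [8, 15, 39, 40], [2, 8, 38, 39], [2, 8, 38, 40], [8, 38, 39, 40], [1, 37, 38, 39],
   [1, 37, 38, 40], [1, 37, 39, 40], [1, 3, 9, 23], [1, 3, 16, 23], [1, 9, 16, 23], [3, 9, 16, 23],
   [1, 3, 16, 40], [1, 9, 16, 40], [3, 9, 16, 40], [1, 3, 9, 39], [1, 9, 39, 40], [3, 9, 39, 40],
   [1, 2, 38, 39], [1, 2, 38, 40], [1, 2, 4, 17], [1, 2, 10, 17], [1, 4, 10, 17], [2, 4, 10, 17],
   [1, 2, 10, 40], [1, 4, 10, 40], [2, 4, 10, 40], [1, 2, 3, 39], [2, 3, 39, 40], [1, 2, 3, 11],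
   [1, 2, 5, 11], [1, 3, 5, 11], [2, 3, 5, 11], [1, 3, 4, 40], [2, 3, 4, 40], [1, 2, 4, 5],
   [1, 3, 4, 5], [2, 3, 4, 5]]

theorem gd_iff {l : List ℕ} : gd l = true ↔ l.Pairwise (· < ·) ∧ ∀ n ∈ l, n < 41 := by
  simp [gd]

theorem beqL_iff : ∀ a b : List ℕ, beqL a b = true ↔ a = b
  | [], [] => by simp [beqL]
  | [], _ :: _ => by simp [beqL]
  | _ :: _, [] => by simp [beqL]
  | a :: l, b :: m => by
      simp only [beqL, List.cons.injEq, ← beqL_iff l m]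
      cases h : Nat.beq a b
      · have : a ≠ b := by intro e; subst e; simp at h
        simp [this]
      · have := Nat.eq_of_beq_eq_true h
        simp [this]

theorem cnt_eq : ∀ L : List (List ℕ), cnt L = L.toFinset.card
  | [] => by simp [cnt]
  | a :: l => by
      have h : l.any (beqL a) = true ↔ a ∈ l := by simp [beqL_iff]
      rw [List.toFinset_cons, cnt, cnt_eq l]
      by_cases ha : a ∈ l
      · rw [h.2 ha, Finset.insert_eq_of_mem (by simpa using ha)]; rfl
      · have : l.any (beqL a) = false := by
          rw [← Bool.not_eq_true, h]; exact ha
        rw [this, Finset.card_insert_of_notMem (by simpa using ha)]; rfl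

theorem subB_iff {t l : List ℕ} : subB t l = true ↔ ∀ n ∈ t, n ∈ l := by
  simp [subB]

theorem cast_inj41 {a b : ℕ} (ha : a < 41) (hb : b < 41) (x : ZMod 41)
    (h : (a : ZMod 41) + x = (b : ZMod 41) + x) : a = b := by
  have h1 := (ZMod.natCast_eq_natCast_iff' a b 41).1 (add_right_cancel h)
  rwa [Nat.mod_eq_of_lt ha, Nat.mod_eq_of_lt hb] at h1

theorem mem_cd {x a : ZMod 41} {l : List ℕ} : a ∈ cd x l ↔ ∃ n ∈ l, (n : ZMod 41) + x = a := by
  simp [cd]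

theorem mem_cds {x : ZMod 41} {L : List (List ℕ)} {σ : Finset (ZMod 41)} :
    σ ∈ cds x L ↔ ∃ l ∈ L, cd x l = σ := by
  simp [cds]

theorem mem_cd' {x : ZMod 41} {l : List ℕ} (hl : gd l = true) {n : ℕ} (hn : n < 41) :
    (n : ZMod 41) + x ∈ cd x l ↔ n ∈ l := by
  rw [mem_cd]
  constructor
  · rintro ⟨m, hm, h⟩
    rwa [← cast_inj41 ((gd_iff.1 hl).2 m hm) hn x h]
  · exact fun h => ⟨n, h, rfl⟩

theorem cd_subset {x : ZMod 41} {t l : List ℕ} (ht : gd t = true) (hl : gd l = true) :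
    cd x t ⊆ cd x l ↔ subB t l = true := by
  rw [subB_iff]
  constructor
  · intro h n hn
    exact (mem_cd' hl ((gd_iff.1 ht).2 n hn)).1 (h (mem_cd.2 ⟨n, hn, rfl⟩))
  · intro h a ha
    obtain ⟨n, hn, rfl⟩ := mem_cd.1 ha
    exact mem_cd.2 ⟨n, h n hn, rfl⟩

theorem cd_inj {x : ZMod 41} {t l : List ℕ} (ht : gd t = true) (hl : gd l = true)
    (h : cd x t = cd x l) : t = l := by
  have h1 := subB_iff.1 ((cd_subset ht hl).1 h.subset)
  have h2 := subB_iff.1 ((cd_subset hl ht).1 h.symm.subset)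
  have pt := (gd_iff.1 ht).1
  have pl := (gd_iff.1 hl).1
  have hp : t.Perm l := (List.perm_ext_iff_of_nodup (pt.imp (fun h => ne_of_lt h))
    (pl.imp (fun h => ne_of_lt h))).2 (fun a => ⟨h1 a, h2 a⟩)
  exact hp.eq_of_pairwise (fun a b _ _ h1 h2 => absurd h1 (lt_asymm h2)) pt pl

theorem cd_card {x : ZMod 41} {l : List ℕ} (hl : gd l = true) : (cd x l).card = l.length := by
  have := gd_iff.1 hl
  rw [cd, List.toFinset_card_of_nodup, List.length_map]
  refine List.Nodup.map_on ?_ (this.1.imp (fun h => ne_of_lt h))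
  intro a ha b hb h
  exact cast_inj41 (this.2 a ha) (this.2 b hb) x h

theorem gd_sublist {t l : List ℕ} (h : t.Sublist l) (hl : gd l = true) : gd t = true := by
  rw [gd_iff] at *
  exact ⟨hl.1.sublist h, fun n hn => hl.2 n (h.subset hn)⟩

theorem mem_psc {x : ZMod 41} {l : List ℕ} (hl : gd l = true) {k : ℕ} {τ : Finset (ZMod 41)} :
    τ ∈ (cd x l).powersetCard k ↔ ∃ t ∈ List.sublistsLen k l, cd x t = τ := by
  classical
  rw [Finset.mem_powersetCard]
  constructor
  · rintro ⟨h, hc⟩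
    have hs : (l.filter (fun n : ℕ => decide ((n : ZMod 41) + x ∈ τ))).Sublist l :=
      List.filter_sublist
    have he : cd x (l.filter (fun n : ℕ => decide ((n : ZMod 41) + x ∈ τ))) = τ := by
      ext a
      rw [mem_cd]
      constructor
      · rintro ⟨n, hn, rfl⟩
        simpa using (List.mem_filter.1 hn).2
      · intro ha
        obtain ⟨n, hn, rfl⟩ := mem_cd.1 (h ha)
        exact ⟨n, List.mem_filter.2 ⟨hn, by simpa using ha⟩, rfl⟩
    refine ⟨_, List.mem_sublistsLen.2 ⟨hs, ?_⟩, he⟩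
    rw [← cd_card (x := x) (gd_sublist hs hl), he, hc]
  · rintro ⟨t, ht, rfl⟩
    obtain ⟨hs, hk⟩ := List.mem_sublistsLen.1 ht
    refine ⟨(cd_subset (gd_sublist hs hl) hl).2 (subB_iff.2 (fun n hn => hs.subset hn)), ?_⟩
    rw [cd_card (gd_sublist hs hl), hk]

theorem gd_faces {L : List (List ℕ)} (hL : ∀ l ∈ L, gd l = true) (k : ℕ) :
    ∀ t ∈ facesL k L, gd t = true := by
  intro t ht
  obtain ⟨l, hl, h⟩ := List.mem_flatMap.1 ht
  exact gd_sublist (List.mem_sublistsLen.1 h).1 (hL l hl)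

theorem faces_cds {x : ZMod 41} {L : List (List ℕ)} (hL : ∀ l ∈ L, gd l = true) (k : ℕ) :
    ((cds x L).biUnion fun σ => σ.powersetCard k) = cds x (facesL k L) := by
  ext τ
  rw [Finset.mem_biUnion, mem_cds]
  constructor
  · rintro ⟨σ, hσ, h⟩
    obtain ⟨l, hl, rfl⟩ := mem_cds.1 hσ
    obtain ⟨t, ht, rfl⟩ := (mem_psc (hL l hl)).1 h
    exact ⟨t, List.mem_flatMap.2 ⟨l, hl, ht⟩, rfl⟩
  · rintro ⟨t, ht, rfl⟩
    obtain ⟨l, hl, h⟩ := List.mem_flatMap.1 ht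
    exact ⟨cd x l, mem_cds.2 ⟨l, hl, rfl⟩, (mem_psc (hL l hl)).2 ⟨t, h, rfl⟩⟩

theorem card_cds {x : ZMod 41} {L : List (List ℕ)} (hL : ∀ l ∈ L, gd l = true) :
    (cds x L).card = cnt L := by
  rw [cnt_eq, cds, Finset.card_image_of_injOn]
  intro a ha b hb h
  exact cd_inj (hL a (by simpa using ha)) (hL b (by simpa using hb)) h

theorem star_cds {x : ZMod 41} {L : List (List ℕ)} (hL : ∀ l ∈ L, gd l = true)
    {t : List ℕ} (ht : gd t = true) :
    ((cds x L).filter fun σ => cd x t ⊆ σ) = cds x (starF t L) := by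
  ext τ
  rw [Finset.mem_filter, mem_cds, mem_cds]
  constructor
  · rintro ⟨⟨l, hl, rfl⟩, h⟩
    exact ⟨l, List.mem_filter.2 ⟨hl, (cd_subset ht (hL l hl)).1 h⟩, rfl⟩
  · rintro ⟨l, hl, rfl⟩
    obtain ⟨hl, h⟩ := List.mem_filter.1 hl
    exact ⟨⟨l, hl, rfl⟩, (cd_subset ht (hL l hl)).2 h⟩

theorem gd_star {L : List (List ℕ)} (hL : ∀ l ∈ L, gd l = true) (t : List ℕ) :
    ∀ l ∈ starF t L, gd l = true := fun l hl => hL l (List.mem_filter.1 hl).1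

theorem card_star {x : ZMod 41} {L : List (List ℕ)} (hL : ∀ l ∈ L, gd l = true)
    {t : List ℕ} (ht : gd t = true) :
    ((cds x L).filter fun σ => cd x t ⊆ σ).card = cnt (starF t L) := by
  rw [star_cds hL ht, card_cds (gd_star hL t)]

theorem bdry_cds {x : ZMod 41} {L : List (List ℕ)} (hL : ∀ l ∈ L, gd l = true) (d : ℕ) :
    bdryFacets d (cds x L) = cds x (bdL d L) := by
  ext τ
  rw [bdryFacets, faces_cds hL, Finset.mem_filter, mem_cds, mem_cds]
  constructor
  · rintro ⟨⟨t, ht, rfl⟩, h⟩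
    rw [card_star hL (gd_faces hL d t ht)] at h
    exact ⟨t, List.mem_filter.2 ⟨ht, by simp [h]⟩, rfl⟩
  · rintro ⟨t, ht, rfl⟩
    obtain ⟨ht, h⟩ := List.mem_filter.1 ht
    refine ⟨⟨t, ht, rfl⟩, ?_⟩
    rw [card_star hL (gd_faces hL d t ht)]
    exact Nat.eq_of_beq_eq_true h

theorem stk_sound (x : ZMod 41) : ∀ L : List (List ℕ), (∀ l ∈ L, gd l = true) → L.Nodup →
    stk L = true → IsStackedBall 4 (cds x L)
  | [], _, _, h => by simp [stk] at h
  | [a], hL, _, h => by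
      have : cds x [a] = {cd x a} := by simp [cds]
      rw [this]
      refine IsStackedBall.single 4 _ ?_
      rw [cd_card (hL a (by simp))]
      exact Nat.eq_of_beq_eq_true h
  | s :: r :: L, hL, hn, h => by
      rw [stk, Bool.and_eq_true, Bool.and_eq_true, List.any_eq_true] at h
      obtain ⟨⟨h1, h2⟩, t, ht, h3⟩ := h
      rw [Bool.and_eq_true] at h3
      obtain ⟨h3, h4⟩ := h3
      have hL' : ∀ l ∈ r :: L, gd l = true := fun l hl => hL l (List.mem_cons_of_mem _ hl)
      have hs : gd s = true := hL s (by simp)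
      obtain ⟨hts, htl⟩ := List.mem_sublistsLen.1 ht
      have hgt := gd_sublist hts hs
      have ih := stk_sound x (r :: L) hL' (List.nodup_cons.1 hn).2 h1
      have he : cds x (s :: r :: L) = insert (cd x s) (cds x (r :: L)) := by
        simp [cds]
      rw [he]
      refine IsStackedBall.glue 4 _ (cd x s) (cd x t) ih ?_ ?_ ?_ ?_ ?_ ?_
      · rw [cd_card hs]; exact Nat.eq_of_beq_eq_true h2
      · intro hm
        obtain ⟨l, hl, e⟩ := mem_cds.1 hm
        have := cd_inj (hL' l hl) hs e
        subst this
        exact (List.nodup_cons.1 hn).1 hl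
      · exact (cd_subset hgt hs).2 (subB_iff.2 (fun n hn => hts.subset hn))
      · rw [cd_card hgt, htl]
      · have hc := card_star (x := x) hL' hgt
        rw [Nat.eq_of_beq_eq_true h3, Finset.card_eq_one] at hc
        obtain ⟨ρ, hρ⟩ := hc
        refine ⟨ρ, ?_, ?_⟩
        · have : ρ ∈ ((cds x (r :: L)).filter fun σ => cd x t ⊆ σ) := by rw [hρ]; simp
          simpa using this
        · intro y hy
          have : y ∈ ((cds x (r :: L)).filter fun σ => cd x t ⊆ σ) := Finset.mem_filter.2 hy
          rw [hρ] at this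
          simpa using this
      · intro ρ hρ a ha
        obtain ⟨l, hl, rfl⟩ := mem_cds.1 hρ
        rw [Finset.mem_inter] at ha
        obtain ⟨ha1, ha2⟩ := ha
        obtain ⟨n, hn', rfl⟩ := mem_cd.1 ha2
        have hn41 := (gd_iff.1 hs).2 n hn'
        have hnl := (mem_cd' (hL' l hl) hn41).1 ha1
        have h5 := List.all_eq_true.1 (List.all_eq_true.1 h4 l hl) n hn'
        have h6 : l.any (Nat.beq n) = true := List.any_eq_true.2 ⟨n, hnl, by simp⟩
        rw [h6] at h5
        obtain ⟨m, hm, hb⟩ := List.any_eq_true.1 h5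
        have := Nat.eq_of_beq_eq_true hb
        subst this
        exact mem_cd.2 ⟨n, hm, rfl⟩

/-! ### Computations -/

theorem lk36_gd : ∀ l ∈ lk36, gd l = true := by decide +kernel
theorem lk36_nodup : lk36.Nodup := by decide +kernel
theorem lk36_stk : stk lk36 = true := by decide +kernel
theorem lk36_bd : (bdL 4 lk36).all (fun l => bd110.any (beqL l)) = true
    ∧ bd110.all (fun l => (bdL 4 lk36).any (beqL l)) = true := by decide +kernel
theorem bd110_gd : ∀ l ∈ bd110, gd l = true := by decide +kernel
theorem bd110_two : (facesL 3 bd110).all (fun t => Nat.ble (cnt (starF t bd110)) 2) = true := by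
  decide +kernel
theorem bd110_c0 : cnt (facesL 0 bd110) = 1 := by decide +kernel
theorem bd110_c1 : cnt (facesL 1 bd110) = 40 := by decide +kernel
theorem bd110_c2 : cnt (facesL 2 bd110) = 150 := by decide +kernel
theorem bd110_c3 : cnt (facesL 3 bd110) = 220 := by decide +kernel
theorem bd110_c4 : cnt (facesL 4 bd110) = 110 := by decide +kernel
theorem bd110_nb : (List.range 41).all
    (fun n => cond (Nat.beq n 0) true (bd110.any (fun l => l.any (Nat.beq n)))) = true := by
  decide +kernel
theorem base_link : (baseA41.biUnion fun b => b.image fun p => (shift41 (-p) b).erase 0)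
    = cds 0 lk36 := by
  decide +kernel

/-! ### Links, boundaries and shifts -/

theorem mem_link {F : Finset (Finset V)} {x : V} {ρ : Finset V} :
    ρ ∈ linkFacets F x ↔ x ∉ ρ ∧ insert x ρ ∈ F := by
  rw [linkFacets, Finset.mem_image]
  constructor
  · rintro ⟨σ, hσ, rfl⟩
    rw [Finset.mem_filter] at hσ
    exact ⟨Finset.notMem_erase x σ, by rw [Finset.insert_erase hσ.2]; exact hσ.1⟩
  · rintro ⟨h1, h2⟩
    exact ⟨insert x ρ, Finset.mem_filter.2 ⟨h2, Finset.mem_insert_self _ _⟩,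
      Finset.erase_insert h1⟩

theorem mem_bdry {F : Finset (Finset V)} {d : ℕ} {τ : Finset V} :
    τ ∈ bdryFacets d F ↔ τ.card = d ∧ (F.filter fun σ => τ ⊆ σ).card = 1 := by
  rw [bdryFacets, Finset.mem_filter, Finset.mem_biUnion]
  constructor
  · rintro ⟨⟨σ, _, h⟩, h'⟩
    exact ⟨(Finset.mem_powersetCard.1 h).2, h'⟩
  · rintro ⟨h, h'⟩
    refine ⟨?_, h'⟩
    obtain ⟨σ, hσ⟩ := Finset.card_pos.1 (by omega : 0 < (F.filter fun σ => τ ⊆ σ).card)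
    rw [Finset.mem_filter] at hσ
    exact ⟨σ, hσ.1, Finset.mem_powersetCard.2 ⟨hσ.2, h⟩⟩

theorem link_star {F : Finset (Finset V)} {x : V} {τ : Finset V} (hx : x ∉ τ) :
    ((linkFacets F x).filter fun σ => τ ⊆ σ).card =
      (F.filter fun σ => insert x τ ⊆ σ).card := by
  refine Finset.card_bij (fun σ _ => insert x σ) ?_ ?_ ?_
  · intro σ hσ
    rw [Finset.mem_filter, mem_link] at hσ
    exact Finset.mem_filter.2 ⟨hσ.1.2, Finset.insert_subset_insert x hσ.2⟩
  · intro a ha b hb h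
    rw [Finset.mem_filter, mem_link] at ha hb
    rw [← Finset.erase_insert ha.1.1, ← Finset.erase_insert hb.1.1, h]
  · intro σ hσ
    rw [Finset.mem_filter] at hσ
    have hxσ : x ∈ σ := hσ.2 (Finset.mem_insert_self _ _)
    refine ⟨σ.erase x, ?_, Finset.insert_erase hxσ⟩
    rw [Finset.mem_filter, mem_link, Finset.insert_erase hxσ]
    refine ⟨⟨Finset.notMem_erase _ _, hσ.1⟩, ?_⟩
    exact Finset.subset_erase.2 ⟨(Finset.subset_insert _ _).trans hσ.2, hx⟩

theorem link_bdry (F : Finset (Finset V)) (d : ℕ) (x : V) :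
    linkFacets (bdryFacets (d + 1) F) x = bdryFacets d (linkFacets F x) := by
  ext ρ
  rw [mem_link, mem_bdry, mem_bdry]
  constructor
  · rintro ⟨h1, h2, h3⟩
    rw [link_star h1]
    rw [Finset.card_insert_of_notMem h1] at h2
    exact ⟨by omega, h3⟩
  · rintro ⟨h2, h3⟩
    have h1 : x ∉ ρ := by
      obtain ⟨σ, hσ⟩ := Finset.card_pos.1
        (by omega : 0 < ((linkFacets F x).filter fun σ => ρ ⊆ σ).card)
      rw [Finset.mem_filter, mem_link] at hσ
      exact fun h => hσ.1.1 (hσ.2 h)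
    rw [link_star h1] at h3
    exact ⟨h1, by rw [Finset.card_insert_of_notMem h1, h2], h3⟩

theorem link_faces (F : Finset (Finset V)) (k : ℕ) (x : V) :
    linkFacets (F.biUnion fun σ => σ.powersetCard (k + 1)) x =
      (linkFacets F x).biUnion fun σ => σ.powersetCard k := by
  ext ρ
  rw [mem_link, Finset.mem_biUnion, Finset.mem_biUnion]
  constructor
  · rintro ⟨h1, σ, hσ, h⟩
    rw [Finset.mem_powersetCard, Finset.card_insert_of_notMem h1] at h
    have hx : x ∈ σ := h.1 (Finset.mem_insert_self _ _)
    refine ⟨σ.erase x, mem_link.2 ⟨Finset.notMem_erase _ _, ?_⟩, ?_⟩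
    · rwa [Finset.insert_erase hx]
    · rw [Finset.mem_powersetCard, Finset.subset_erase]
      exact ⟨⟨(Finset.subset_insert _ _).trans h.1, h1⟩, by omega⟩
  · rintro ⟨σ, hσ, h⟩
    rw [mem_link] at hσ
    rw [Finset.mem_powersetCard] at h
    have h1 : x ∉ ρ := fun hx => hσ.1 (h.1 hx)
    refine ⟨h1, insert x σ, hσ.2, ?_⟩
    rw [Finset.mem_powersetCard, Finset.card_insert_of_notMem h1, h.2]
    exact ⟨Finset.insert_subset_insert x h.1, rfl⟩

theorem card_link (F : Finset (Finset V)) (x : V) :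
    (linkFacets F x).card = (F.filter fun σ => x ∈ σ).card := by
  rw [linkFacets, Finset.card_image_of_injOn]
  intro a ha b hb h
  have ha' := (Finset.mem_filter.1 (Finset.mem_coe.1 ha)).2
  have hb' := (Finset.mem_filter.1 (Finset.mem_coe.1 hb)).2
  rw [← Finset.insert_erase ha', ← Finset.insert_erase hb']
  exact congrArg (insert x) h

theorem face_count_of_link [Fintype V] (F : Finset (Finset V)) (k n : ℕ)
    (h : ∀ x, faceCount (linkFacets F x) k = n) :
    faceCount F (k + 1) * (k + 1) = Fintype.card V * n := by
  have h1 : ∀ x, ((F.biUnion fun σ => σ.powersetCard (k + 1)).filter fun σ => x ∈ σ).card = n := by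
    intro x
    rw [← card_link, link_faces, ← h x]
    rfl
  have h2 := Finset.sum_card h1
  rw [← h2, faceCount]
  symm
  apply Finset.sum_const_nat
  intro σ hσ
  obtain ⟨τ, _, hτ⟩ := Finset.mem_biUnion.1 hσ
  exact (Finset.mem_powersetCard.1 hτ).2

attribute [local irreducible] A41 M41 bd110 lk36

theorem mem_A41 {σ : Finset (ZMod 41)} :
    σ ∈ A41 ↔ ∃ j, ∃ b ∈ baseA41, b.image (fun p => p + j) = σ := by
  simp [A41, shift41]

theorem image_add_add (σ : Finset (ZMod 41)) (j k : ZMod 41) :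
    (σ.image (fun p => p + j)).image (fun p => p + k) = σ.image (fun p => p + (j + k)) := by
  rw [Finset.image_image]
  congr 1
  funext p
  simp [add_assoc]

theorem image_add_neg (σ : Finset (ZMod 41)) (k : ZMod 41) :
    (σ.image (fun p => p + k)).image (fun p => p + -k) = σ := by
  rw [image_add_add]
  simp

theorem image_neg_add (σ : Finset (ZMod 41)) (k : ZMod 41) :
    (σ.image (fun p => p + -k)).image (fun p => p + k) = σ := by
  rw [image_add_add]
  simp

theorem A41_shift {σ : Finset (ZMod 41)} (k : ZMod 41) (h : σ ∈ A41) :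
    σ.image (fun p => p + k) ∈ A41 := by
  obtain ⟨j, b, hb, rfl⟩ := mem_A41.1 h
  rw [image_add_add]
  exact mem_A41.2 ⟨_, b, hb, rfl⟩

theorem M41_shift {τ : Finset (ZMod 41)} (k : ZMod 41) (h : τ ∈ M41) :
    τ.image (fun p => p + k) ∈ M41 := by
  rw [M41, mem_bdry] at *
  refine ⟨?_, ?_⟩
  · rw [Finset.card_image_of_injective _ (add_left_injective k), h.1]
  · rw [← h.2]
    symm
    refine Finset.card_bij (fun σ _ => σ.image (fun p => p + k)) ?_ ?_ ?_
    · intro σ hσ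
      rw [Finset.mem_filter] at *
      exact ⟨A41_shift k hσ.1, Finset.image_subset_image hσ.2⟩
    · intro a _ b _ hab
      exact Finset.image_injective (add_left_injective k) hab
    · intro σ hσ
      rw [Finset.mem_filter] at hσ
      refine ⟨σ.image (fun p => p + -k), ?_, image_neg_add σ k⟩
      rw [Finset.mem_filter]
      refine ⟨A41_shift _ hσ.1, ?_⟩
      rw [← image_add_neg τ k]
      exact Finset.image_subset_image hσ.2

theorem M41_shift_iff (τ : Finset (ZMod 41)) (k : ZMod 41) :
    τ ∈ M41 ↔ τ.image (fun p => p + k) ∈ M41 := by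
  refine ⟨M41_shift k, fun h => ?_⟩
  have := M41_shift (-k) h
  rwa [image_add_neg] at this

theorem cd_shift (x : ZMod 41) (l : List ℕ) : (cd 0 l).image (fun p => p + x) = cd x l := by
  ext a
  simp only [Finset.mem_image, mem_cd, add_zero]
  constructor
  · rintro ⟨_, ⟨n, hn, rfl⟩, rfl⟩
    exact ⟨n, hn, rfl⟩
  · rintro ⟨n, hn, rfl⟩
    exact ⟨_, ⟨n, hn, rfl⟩, rfl⟩

theorem erase_shift (x p : ZMod 41) (b : Finset (ZMod 41)) :
    ((shift41 (-p) b).erase 0).image (fun q => q + x)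
      = (b.image (fun q => q + (x - p))).erase x := by
  rw [Finset.image_erase (add_left_injective x), shift41, image_add_add]
  simp [sub_eq_neg_add]

theorem link_A41 (x : ZMod 41) : linkFacets A41 x = cds x lk36 := by
  have key : ∀ σ : Finset (ZMod 41), (∃ b ∈ baseA41, ∃ p ∈ b, (shift41 (-p) b).erase 0 = σ) ↔
      ∃ l ∈ lk36, cd 0 l = σ := by
    intro σ
    rw [← mem_cds, ← base_link]
    simp
  ext σ
  rw [mem_cds]
  constructor
  · intro h
    rw [mem_link] at h
    obtain ⟨h1, h2⟩ := h
    obtain ⟨j, b, hb, e⟩ := mem_A41.1 h2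
    have hx : x ∈ b.image (fun p => p + j) := by rw [e]; exact Finset.mem_insert_self _ _
    obtain ⟨p, hp, hpx⟩ := Finset.mem_image.1 hx
    have hj : j = x - p := by rw [← hpx]; ring
    obtain ⟨l, hl, e'⟩ := (key _).1 ⟨b, hb, p, hp, rfl⟩
    refine ⟨l, hl, ?_⟩
    rw [← cd_shift, e', erase_shift, ← hj, e, Finset.erase_insert h1]
  · rintro ⟨l, hl, rfl⟩
    obtain ⟨b, hb, p, hp, e⟩ := (key _).2 ⟨l, hl, rfl⟩
    rw [← cd_shift, ← e, erase_shift, mem_link]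
    refine ⟨Finset.notMem_erase _ _, ?_⟩
    rw [Finset.insert_erase (Finset.mem_image.2 ⟨p, hp, by ring⟩)]
    exact mem_A41.2 ⟨_, b, hb, rfl⟩

theorem cds_bd (x : ZMod 41) : bdryFacets 4 (cds x lk36) = cds x bd110 := by
  rw [bdry_cds lk36_gd]
  have h : (bdL 4 lk36).toFinset = bd110.toFinset := by
    ext l
    rw [List.mem_toFinset, List.mem_toFinset]
    constructor
    · intro hl
      obtain ⟨m, hm, e⟩ := List.any_eq_true.1 (List.all_eq_true.1 lk36_bd.1 l hl)
      rwa [(beqL_iff _ _).1 e]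
    · intro hl
      obtain ⟨m, hm, e⟩ := List.any_eq_true.1 (List.all_eq_true.1 lk36_bd.2 l hl)
      rwa [(beqL_iff _ _).1 e]
  rw [cds, cds, h]

theorem link_M41 (x : ZMod 41) : linkFacets M41 x = cds x bd110 := by
  rw [M41, link_bdry, link_A41, cds_bd]

theorem link_faceCount (x : ZMod 41) (k : ℕ) :
    faceCount (linkFacets M41 x) k = cnt (facesL k bd110) := by
  rw [link_M41, faceCount, faces_cds bd110_gd, card_cds (gd_faces bd110_gd k)]

theorem M41_faceCount (k j n m : ℕ) (hj : j = k + 1) (hn : cnt (facesL k bd110) = n)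
    (hm : m * j = 41 * n) : faceCount M41 j = m := by
  subst hj
  refine Nat.eq_of_mul_eq_mul_right (Nat.succ_pos k) ?_
  rw [← Nat.succ_eq_add_one] at hm
  refine Eq.trans ?_ hm.symm
  rw [← hn]
  have := face_count_of_link M41 k _ (fun x => link_faceCount x k)
  rwa [ZMod.card] at this

theorem M41_nb (x y : ZMod 41) (h : x ≠ y) : ∃ τ ∈ M41, x ∈ τ ∧ y ∈ τ := by
  have hn : (y - x).val < 41 := ZMod.val_lt _
  have h0 : (y - x).val ≠ 0 := by
    rw [Ne, ZMod.val_eq_zero, sub_eq_zero]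
    exact fun e => h e.symm
  have h1 := List.all_eq_true.1 bd110_nb (y - x).val (List.mem_range.2 hn)
  have h2 : Nat.beq (y - x).val 0 = false := by
    rw [← Bool.not_eq_true]
    exact fun e => h0 (Nat.eq_of_beq_eq_true e)
  rw [h2] at h1
  obtain ⟨l, hl, h3⟩ := List.any_eq_true.1 h1
  obtain ⟨m, hm, h4⟩ := List.any_eq_true.1 h3
  have h5 := Nat.eq_of_beq_eq_true h4
  have h6 : cd x l ∈ linkFacets M41 x := by
    rw [link_M41]; exact mem_cds.2 ⟨l, hl, rfl⟩
  refine ⟨insert x (cd x l), (mem_link.1 h6).2, Finset.mem_insert_self _ _,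
    Finset.mem_insert_of_mem (mem_cd.2 ⟨m, hm, ?_⟩)⟩
  rw [← h5, ZMod.natCast_zmod_val]
  ring

theorem M41_vertex (x : ZMod 41) : ∃ τ ∈ M41, x ∈ τ := by
  obtain ⟨τ, h, hx, _⟩ := M41_nb x (x + 1) (by
    intro h
    exact absurd (left_eq_add.1 h) (by decide))
  exact ⟨τ, h, hx⟩

theorem M41_card (τ : Finset (ZMod 41)) (h : τ ∈ M41) : τ.card = 5 := by
  rw [M41, mem_bdry] at h
  exact h.1

theorem M41_two (s : Finset (ZMod 41)) (hs : s.card = 4) :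
    (M41.filter fun τ => s ⊆ τ).card ≤ 2 := by
  obtain ⟨x, hx⟩ := Finset.card_pos.1 (by omega : 0 < s.card)
  have h1 := link_star (F := M41) (Finset.notMem_erase x s)
  rw [Finset.insert_erase hx, link_M41] at h1
  rw [← h1]
  rcases Finset.eq_empty_or_nonempty ((cds x bd110).filter fun σ => s.erase x ⊆ σ) with h | ⟨σ, h⟩
  · rw [h]; simp
  · rw [Finset.mem_filter] at h
    have h2 : s.erase x ∈ (cds x bd110).biUnion fun σ => σ.powersetCard 3 :=
      Finset.mem_biUnion.2 ⟨σ, h.1, Finset.mem_powersetCard.2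
        ⟨h.2, by rw [Finset.card_erase_of_mem hx, hs]⟩⟩
    rw [faces_cds bd110_gd, mem_cds] at h2
    obtain ⟨t, ht, e⟩ := h2
    rw [← e, card_star bd110_gd (gd_faces bd110_gd 3 t ht)]
    exact Nat.le_of_ble_eq_true (List.all_eq_true.1 bd110_two t ht)

theorem M41_sphere (x : ZMod 41) : IsStackedSphere 3 (linkFacets M41 x) :=
  ⟨cds x lk36, stk_sound x lk36 lk36_gd lk36_nodup lk36_stk, by rw [link_M41, cds_bd]⟩

/-- `M⁴₄₁ = ∂A⁵₄₁` is a 2-neighborly 4-dimensional weak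
pseudomanifold on 41 vertices admitting the vertex-transitive automorphism
`a_i ↦ a_{i+1}`, every vertex link is a stacked 3-sphere (so `M⁴₄₁ ∈ K(4)`), its
face vector is (41, 820, 2050, 2255, 902), and its Euler characteristic is χ = -82,
so that `f₀ (f₀ - 11) = -15 χ`. -/
theorem stmt18 :
    (∀ τ ∈ M41, τ.card = 5) ∧
      (∀ s : Finset (ZMod 41), s.card = 4 → (M41.filter fun τ => s ⊆ τ).card ≤ 2) ∧
      (vertexSet M41).card = 41 ∧
      (∀ x ∈ vertexSet M41, ∀ y ∈ vertexSet M41, ∃ τ ∈ M41, x ∈ τ ∧ y ∈ τ) ∧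
      (∀ τ : Finset (ZMod 41), τ ∈ M41 ↔ τ.image (fun i => i + 1) ∈ M41) ∧
      (∀ x y : ZMod 41, ∃ k : ZMod 41, x + k = y ∧
        ∀ τ : Finset (ZMod 41), τ ∈ M41 ↔ τ.image (fun i => i + k) ∈ M41) ∧
      (∀ x ∈ vertexSet M41, IsStackedSphere 3 (linkFacets M41 x)) ∧
      (faceCount M41 1 = 41 ∧ faceCount M41 2 = 820 ∧ faceCount M41 3 = 2050 ∧
        faceCount M41 4 = 2255 ∧ faceCount M41 5 = 902) ∧
      ((faceCount M41 1 : ℤ) - faceCount M41 2 + faceCount M41 3 - faceCount M41 4 +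
        faceCount M41 5 = -82) ∧
      ((faceCount M41 1 : ℤ) * ((faceCount M41 1 : ℤ) - 11) =
        -15 * ((faceCount M41 1 : ℤ) - faceCount M41 2 + faceCount M41 3 -
          faceCount M41 4 + faceCount M41 5)) := by

  have c1 : faceCount M41 1 = 41 := by
    exact M41_faceCount 0 1 1 41 (by norm_num) bd110_c0 (by norm_num)
  have c2 : faceCount M41 2 = 820 := by
    exact M41_faceCount 1 2 40 820 (by norm_num) bd110_c1 (by norm_num)
  have c3 : faceCount M41 3 = 2050 := by
    exact M41_faceCount 2 3 150 2050 (by norm_num) bd110_c2 (by norm_num)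
  have c4 : faceCount M41 4 = 2255 := by
    exact M41_faceCount 3 4 220 2255 (by norm_num) bd110_c3 (by norm_num)
  have c5 : faceCount M41 5 = 902 := by
    exact M41_faceCount 4 5 110 902 (by norm_num) bd110_c4 (by norm_num)
  refine ⟨M41_card, M41_two, ?_, ?_, fun τ => M41_shift_iff τ 1, ?_,
    fun x _ => M41_sphere x, ⟨c1, c2, c3, c4, c5⟩, ?_, ?_⟩
  · have : vertexSet M41 = Finset.univ := by
      rw [Finset.eq_univ_iff_forall]
      intro x
      obtain ⟨τ, h, hx⟩ := M41_vertex x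
      exact Finset.mem_biUnion.2 ⟨τ, h, hx⟩
    rw [this, Finset.card_univ, ZMod.card]
  · intro x _ y _
    by_cases h : x = y
    · subst h
      obtain ⟨τ, h, hx⟩ := M41_vertex x
      exact ⟨τ, h, hx, hx⟩
    · exact M41_nb x y h
  · intro x y
    exact ⟨y - x, by ring, fun τ => M41_shift_iff τ (y - x)⟩
  · rw [c1, c2, c3, c4, c5]; norm_num
  · rw [c1, c2, c3, c4, c5]; norm_num
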